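/- Let G ≅ PSp₄(q) with q = 2^b, b ≥ 2, let S be a Sylow 2-subgroup of G, and let A be an elementary abelian subgroup of S of maximal order (so |A| = q³). If R ≤ S satisfies |RA/A| ≥ 4, then |[R, A]| = q² = 2^{2b}. -/

import Mathlib

/-- The projective symplectic group `PSp₄(q)` over the Galois field of order `q = 2^b`,
realized as `Sp₄(q)` modulo its center. -/
abbrev PSp4 (b : ℕ) : Type :=
  Matrix.symplecticGroup (Fin 2) (GaloisField 2 b) ⧸
    Subgroup.center (Matrix.symplecticGroup (Fin 2) (GaloisField 2 b))

/-- Coordinates for the Sylow 2-subgroup of `Sp₄(F)` in characteristic two. -/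
@[ext] structure UG (F : Type*) where
  t : F
  a : F
  b : F
  c : F

set_option linter.unusedSectionVars false
set_option linter.unusedSimpArgs false

namespace UG

open scoped commutatorElement


variable {F : Type*} [Field F] [CharP F 2]

instance : Mul (UG F) :=
  ⟨fun x y => ⟨x.t + y.t, x.a + y.a + x.t ^ 2 * y.c, x.b + y.b + x.t * y.c, x.c + y.c⟩⟩
instance : One (UG F) := ⟨⟨0, 0, 0, 0⟩⟩
instance : Inv (UG F) := ⟨fun x => ⟨x.t, x.a + x.t ^ 2 * x.c, x.b + x.t * x.c, x.c⟩⟩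

@[simp] lemma mul_t (x y : UG F) : (x * y).t = x.t + y.t := rfl
@[simp] lemma mul_a (x y : UG F) : (x * y).a = x.a + y.a + x.t ^ 2 * y.c := rfl
@[simp] lemma mul_b (x y : UG F) : (x * y).b = x.b + y.b + x.t * y.c := rfl
@[simp] lemma mul_c (x y : UG F) : (x * y).c = x.c + y.c := rfl
@[simp] lemma one_t : (1 : UG F).t = 0 := rfl
@[simp] lemma one_a : (1 : UG F).a = 0 := rfl
@[simp] lemma one_b : (1 : UG F).b = 0 := rfl
@[simp] lemma one_c : (1 : UG F).c = 0 := rfl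
@[simp] lemma inv_t (x : UG F) : (x⁻¹).t = x.t := rfl
@[simp] lemma inv_a (x : UG F) : (x⁻¹).a = x.a + x.t ^ 2 * x.c := rfl
@[simp] lemma inv_b (x : UG F) : (x⁻¹).b = x.b + x.t * x.c := rfl
@[simp] lemma inv_c (x : UG F) : (x⁻¹).c = x.c := rfl

lemma two0 : (2 : F) = 0 := CharTwo.two_eq_zero

instance : Group (UG F) := Group.ofLeftAxioms
  (by
    intro x y z
    ext
    · simp; ring
    · simp; linear_combination (x.t * y.t * z.c) * (two0 (F := F))
    · simp; ring
    · simp; ring)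
  (by intro x; ext <;> simp)
  (by
    intro x
    ext
    · simp; linear_combination x.t * (two0 (F := F))
    · simp; linear_combination (x.a + x.t ^ 2 * x.c) * (two0 (F := F))
    · simp; linear_combination (x.b + x.t * x.c) * (two0 (F := F))
    · simp; linear_combination x.c * (two0 (F := F)))

/-- The `t`-coordinate homomorphism. -/
def tHom : UG F →* Multiplicative F where
  toFun x := Multiplicative.ofAdd x.t
  map_one' := rfl
  map_mul' _ _ := rfl

/-- The `c`-coordinate homomorphism. -/
def cHom : UG F →* Multiplicative F where
  toFun x := Multiplicative.ofAdd x.c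
  map_one' := rfl
  map_mul' _ _ := rfl

lemma mem_t (x : UG F) : x ∈ (tHom (F := F)).ker ↔ x.t = 0 := Iff.rfl
lemma mem_c (x : UG F) : x ∈ (cHom (F := F)).ker ↔ x.c = 0 := Iff.rfl

lemma card_t : Nat.card (tHom (F := F)).ker = Nat.card F ^ 3 := by
  let e : (tHom (F := F)).ker ≃ F × F × F :=
    { toFun := fun x => (x.1.a, x.1.b, x.1.c)
      invFun := fun y => ⟨⟨0, y.1, y.2.1, y.2.2⟩, rfl⟩
      left_inv := by
        rintro ⟨x, hx⟩
        rw [mem_t] at hx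
        apply Subtype.ext
        ext <;> simp [hx]
      right_inv := fun _ => rfl }
  rw [Nat.card_congr e, Nat.card_prod, Nat.card_prod]; ring

lemma card_c : Nat.card (cHom (F := F)).ker = Nat.card F ^ 3 := by
  let e : (cHom (F := F)).ker ≃ F × F × F :=
    { toFun := fun x => (x.1.t, x.1.a, x.1.b)
      invFun := fun y => ⟨⟨y.1, y.2.1, y.2.2, 0⟩, rfl⟩
      left_inv := by
        rintro ⟨x, hx⟩
        rw [mem_c] at hx
        apply Subtype.ext
        ext <;> simp [hx]
      right_inv := fun _ => rfl }
  rw [Nat.card_congr e, Nat.card_prod, Nat.card_prod]; ring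

lemma card_z : Nat.card ((tHom (F := F)).ker ⊓ (cHom (F := F)).ker : Subgroup (UG F))
    = Nat.card F ^ 2 := by
  let e : ((tHom (F := F)).ker ⊓ (cHom (F := F)).ker : Subgroup (UG F)) ≃ F × F :=
    { toFun := fun x => (x.1.a, x.1.b)
      invFun := fun y => ⟨⟨0, y.1, y.2, 0⟩, ⟨rfl, rfl⟩⟩
      left_inv := by
        rintro ⟨x, hx⟩
        rw [Subgroup.mem_inf, mem_t, mem_c] at hx
        apply Subtype.ext
        ext <;> simp [hx]
      right_inv := fun _ => rfl }
  rw [Nat.card_congr e, Nat.card_prod]; ring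

lemma card_UG : Nat.card (UG F) = Nat.card F ^ 4 := by
  let e : UG F ≃ F × F × F × F :=
    { toFun := fun x => (x.t, x.a, x.b, x.c)
      invFun := fun y => ⟨y.1, y.2.1, y.2.2.1, y.2.2.2⟩
      left_inv := fun _ => rfl
      right_inv := fun _ => rfl }
  rw [Nat.card_congr e, Nat.card_prod, Nat.card_prod, Nat.card_prod]; ring

lemma finite_UG [Finite F] : Finite (UG F) := by
  apply Nat.finite_of_card_ne_zero
  rw [card_UG]
  exact pow_ne_zero _ Nat.card_pos.ne'

lemma comm_eq (x y : UG F) :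
    ⁅x, y⁆ = ⟨0, x.t ^ 2 * y.c + y.t ^ 2 * x.c, x.t * y.c + y.t * x.c, 0⟩ := by
  rw [commutatorElement_def, mul_inv_eq_iff_eq_mul, mul_inv_eq_iff_eq_mul]
  ext
  · simp [add_comm]
  · simp; linear_combination (-y.t ^ 2 * x.c) * (two0 (F := F))
  · simp; linear_combination (-y.t * x.c) * (two0 (F := F))
  · simp [add_comm]

lemma exists_two [Finite F] (f : UG F →* Multiplicative F) (R : Subgroup (UG F))
    (h : 4 * Nat.card (R ⊓ f.ker : Subgroup (UG F)) ≤ Nat.card R) :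
    ∃ r₁ ∈ R, ∃ r₂ ∈ R, f r₁ ≠ 1 ∧ f r₂ ≠ 1 ∧ f r₁ ≠ f r₂ := by
  have := finite_UG (F := F)
  by_contra hcon
  push Not at hcon
  have hk : Nat.card (R ⊓ f.ker : Subgroup (UG F)) = Nat.card (f.domRestrict R).ker := by
    rw [MonoidHom.ker_domRestrict]
    rw [← Subgroup.inf_subgroupOf_left]
    exact (Nat.card_congr (Subgroup.subgroupOfEquivOfLe inf_le_left).toEquiv).symm
  have h1 := Subgroup.card_mul_index (f.domRestrict R).ker
  rw [Subgroup.index_ker, ← hk] at h1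
  have hpos : 0 < Nat.card (R ⊓ f.ker : Subgroup (UG F)) := Nat.card_pos
  have h2 : 4 ≤ Nat.card (f.domRestrict R).range := by
    rw [← h1] at h
    by_contra h3
    push Not at h3
    nlinarith
  have h3 : ∃ x : Multiplicative F, ((f.domRestrict R).range : Set (Multiplicative F)) ⊆ {1, x} := by
    by_cases hx : ∃ r ∈ R, f r ≠ 1
    · obtain ⟨r, hr, hr1⟩ := hx
      refine ⟨f r, ?_⟩
      rintro _ ⟨⟨s, hs⟩, rfl⟩
      by_cases hs1 : f s = 1
      · left; exact hs1
      · right; exact (hcon r hr s hs hr1 hs1).symm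
    · push Not at hx
      refine ⟨1, ?_⟩
      rintro _ ⟨⟨s, hs⟩, rfl⟩
      left; exact hx s hs
  obtain ⟨x, hx⟩ := h3
  have h4 : Nat.card (f.domRestrict R).range ≤ 2 :=
    (Set.ncard_le_ncard hx (by simp)).trans ((Set.ncard_insert_le _ _).trans (by simp))
  omega

theorem core [Finite F] (A R : Subgroup (UG F)) (hAel : ∀ x ∈ A, x * x = 1)
    (hA : Nat.card F ^ 3 ≤ Nat.card A)
    (hRA : 4 * Nat.card (R ⊓ A : Subgroup (UG F)) ≤ Nat.card R) :
    Nat.card (⁅R, A⁆ : Subgroup (UG F)) = Nat.card F ^ 2 := by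
  have := finite_UG (F := F)
  have hcase : A ≤ (tHom (F := F)).ker ∨ A ≤ (cHom (F := F)).ker := by
    by_contra hcon
    push Not at hcon
    obtain ⟨h1, h2⟩ := hcon
    have key : ∀ x ∈ A, x.t = 0 ∨ x.c = 0 := by
      intro x hx
      have := congrArg UG.a (hAel x hx)
      simp only [mul_a, one_a, CharTwo.add_self_eq_zero, zero_add] at this
      rcases mul_eq_zero.1 this with h | h
      · left; exact pow_eq_zero_iff (two_ne_zero) |>.1 h
      · right; exact h
    obtain ⟨x, hx, hxt⟩ := SetLike.not_le_iff_exists.1 h1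
    obtain ⟨y, hy, hyc⟩ := SetLike.not_le_iff_exists.1 h2
    rw [mem_t] at hxt
    rw [mem_c] at hyc
    have hxc := (key x hx).resolve_left hxt
    have hyt := (key y hy).resolve_right hyc
    have := key _ (A.mul_mem hx hy)
    simp [hxc, hyt, hxt, hyc] at this
  have hle : ⁅R, A⁆ ≤ (tHom (F := F)).ker ⊓ (cHom (F := F)).ker := by
    rw [Subgroup.commutator_le]
    intro r _ s _
    rw [Subgroup.mem_inf, mem_t, mem_c, comm_eq]
    exact ⟨rfl, rfl⟩
  rw [← card_z]
  congr 1
  suffices h : (tHom (F := F)).ker ⊓ (cHom (F := F)).ker ≤ ⁅R, A⁆ by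
    rw [le_antisymm hle h]
  rintro ⟨t, α, β, c⟩ ⟨ht, hc⟩
  change t = 0 at ht
  change c = 0 at hc
  subst ht hc
  rcases hcase with h | h
  · have hAe := Subgroup.eq_of_le_of_card_ge h (by rw [card_t]; exact hA)
    subst hAe
    obtain ⟨r, hr, s, hs, h1, h2, h3⟩ := exists_two _ R hRA
    change r.t ≠ 0 at h1
    change s.t ≠ 0 at h2
    change r.t ≠ s.t at h3
    have h4 : r.t + s.t ≠ 0 := fun h => h3 (CharTwo.add_eq_zero.1 h)
    have e : (⟨0, α, β, 0⟩ : UG F) = ⁅r, ⟨0, 0, 0, (α + s.t * β) / (r.t * (r.t + s.t))⟩⁆ *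
        ⁅s, ⟨0, 0, 0, (α + r.t * β) / (s.t * (r.t + s.t))⟩⁆ := by
      rw [comm_eq, comm_eq]
      ext
      · simp
      · simp
        field_simp
        linear_combination (- r.t * s.t * β) * (two0 (F := F))
      · simp
        field_simp
        linear_combination (- α) * (two0 (F := F))
      · simp
    rw [e]
    exact mul_mem (Subgroup.commutator_mem_commutator hr rfl)
      (Subgroup.commutator_mem_commutator hs rfl)
  · have hAe := Subgroup.eq_of_le_of_card_ge h (by rw [card_c]; exact hA)
    subst hAe
    obtain ⟨r, hr, s, hs, h1, h2, h3⟩ := exists_two _ R hRA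
    change r.c ≠ 0 at h1
    change s.c ≠ 0 at h2
    change r.c ≠ s.c at h3
    have h4 : r.c + s.c ≠ 0 := fun h => h3 (CharTwo.add_eq_zero.1 h)
    obtain ⟨w, hw⟩ := FiniteField.isSquare_of_char_two (F := F) (ringChar.eq F 2)
      ((α * r.c + β ^ 2) / (s.c * (r.c + s.c)))
    have hw' : w * w * (s.c * (r.c + s.c)) = α * r.c + β ^ 2 := by
      rw [← hw]; field_simp
    have e : (⟨0, α, β, 0⟩ : UG F) = ⁅r, ⟨(β + w * s.c) / r.c, 0, 0, 0⟩⁆ *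
        ⁅s, ⟨w, 0, 0, 0⟩⁆ := by
      rw [comm_eq, comm_eq]
      ext
      · simp
      · simp
        field_simp
        linear_combination (-1) * hw' + (- β ^ 2 - β * w * s.c) * (two0 (F := F))
      · simp
        field_simp
        linear_combination (- w * s.c) * (two0 (F := F))
      · simp
    rw [e]
    exact mul_mem (Subgroup.commutator_mem_commutator hr rfl)
      (Subgroup.commutator_mem_commutator hs rfl)

end UG

namespace UG

open Matrix

variable {F : Type*} [Field F] [CharP F 2]

/-- The matrix with given coordinates. -/
def mat (x : UG F) : Matrix (Fin 2 ⊕ Fin 2) (Fin 2 ⊕ Fin 2) F :=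
  fromBlocks !![1, x.t; 0, 1] !![x.a + x.b * x.t, x.b; x.b + x.c * x.t, x.c] 0 !![1, 0; x.t, 1]

lemma mat_mem (x : UG F) : mat x ∈ symplecticGroup (Fin 2) F := by
  have h2 := two0 (F := F)
  rw [mat, SymplecticGroup.fromBlocks_mem_iff]
  refine ⟨by simp, ?_, ?_⟩
  · ext i j
    fin_cases i <;> fin_cases j <;> simp [Matrix.mul_apply, Fin.sum_univ_two]
    · ring
    · ring
  · ext i j
    fin_cases i <;> fin_cases j <;> simp [Matrix.mul_apply, Fin.sum_univ_two]
    exact CharTwo.add_self_eq_zero _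

lemma mat_mul (x y : UG F) : mat (x * y) = mat x * mat y := by
  have h2 := two0 (F := F)
  rw [mat, mat, mat, fromBlocks_multiply]
  congr 1
  · ext i j
    fin_cases i <;> fin_cases j <;> simp [Matrix.mul_apply, Fin.sum_univ_two, add_comm]
  · ext i j
    fin_cases i <;> fin_cases j <;> simp [Matrix.mul_apply, Fin.sum_univ_two]
    · linear_combination (x.t ^ 2 * y.c) * h2
    · ring
    · linear_combination (x.t * y.c) * h2
    · ring
  · simp
  · ext i j
    fin_cases i <;> fin_cases j <;> simp [Matrix.mul_apply, Fin.sum_univ_two, add_comm]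

/-- The embedding into the symplectic group. -/
def phi : UG F →* symplecticGroup (Fin 2) F where
  toFun x := ⟨mat x, mat_mem x⟩
  map_one' := by
    apply Subtype.ext
    change mat (1 : UG F) = 1
    rw [mat, ← fromBlocks_one]
    congr 1 <;> ext i j <;> fin_cases i <;> fin_cases j <;> simp
  map_mul' x y := Subtype.ext (mat_mul x y)

lemma phi_inj : Function.Injective (phi (F := F)) := by
  intro x y h
  have h : mat x = mat y := congrArg Subtype.val h
  have ht := congrFun (congrFun h (Sum.inl 0)) (Sum.inl 1)
  have ha := congrFun (congrFun h (Sum.inl 0)) (Sum.inr 0)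
  have hb := congrFun (congrFun h (Sum.inl 0)) (Sum.inr 1)
  have hc := congrFun (congrFun h (Sum.inl 1)) (Sum.inr 1)
  simp [mat] at ht ha hb hc
  rw [ht, hb] at ha
  ext
  · exact ht
  · exact add_right_cancel ha
  · exact hb
  · exact hc

lemma eq_one_of_pow {x : F} {k : ℕ} (h : x ^ 2 ^ k = 1) : x = 1 := by
  have := sub_pow_char_pow (R := F) (p := 2) (n := k) x 1
  rw [h, one_pow, sub_self] at this
  exact sub_eq_zero.1 (pow_eq_zero_iff (by positivity) |>.1 this)

/-- A 2-element normalizing the unitriangular group lies in it. -/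
lemma norm_mem (g : symplecticGroup (Fin 2) F) (k : ℕ) (hk : g ^ 2 ^ k = 1)
    (hn : ∀ x : UG F, ∃ y : UG F, phi x * g = g * phi y) : ∃ y, phi y = g := by
  obtain ⟨g, hg⟩ := g
  have hn' : ∀ x : UG F, ∃ y : UG F, mat x * g = g * mat y := fun x => by
    obtain ⟨y, hy⟩ := hn x
    exact ⟨y, congrArg Subtype.val hy⟩
  have hk' : g ^ 2 ^ k = 1 := congrArg Subtype.val hk
  clear hn hk
  obtain ⟨y1, h1⟩ := hn' ⟨1, 0, 0, 0⟩
  obtain ⟨y2, h2⟩ := hn' ⟨0, 0, 1, 0⟩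
  obtain ⟨y3, h3⟩ := hn' ⟨0, 0, 0, 1⟩
  have e1 := congrFun (congrFun h1 (Sum.inl 0)) (Sum.inl 0)
  have e2 := congrFun (congrFun h1 (Sum.inr 1)) (Sum.inl 0)
  have e3 := congrFun (congrFun h2 (Sum.inl 0)) (Sum.inl 0)
  have e4 := congrFun (congrFun h1 (Sum.inr 1)) (Sum.inl 1)
  have e5 := congrFun (congrFun h3 (Sum.inl 1)) (Sum.inl 1)
  simp [mat, Matrix.mul_apply, Fintype.sum_sum_type, Fin.sum_univ_two] at e1 e2 e3 e4 e5
  simp [e1, e2, e3] at e4 e5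
  have hpow : ∀ n : ℕ, (g ^ n) (Sum.inl 0) (Sum.inl 0) = g (Sum.inl 0) (Sum.inl 0) ^ n ∧
      (g ^ n) (Sum.inl 1) (Sum.inl 0) = 0 ∧
      (g ^ n) (Sum.inl 1) (Sum.inl 1) = g (Sum.inl 1) (Sum.inl 1) ^ n := by
    intro n
    induction n with
    | zero => simp
    | succ n ih =>
      obtain ⟨i1, i2, i3⟩ := ih
      simp only [pow_succ]
      simp [Matrix.mul_apply (M := g ^ n) , Fintype.sum_sum_type, Fin.sum_univ_two, e1, e2, e3, e4, e5, i1, i2, i3]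
  have hp := hpow (2 ^ k)
  rw [hk'] at hp
  simp at hp
  have hl : g (Sum.inl 0) (Sum.inl 0) = 1 := eq_one_of_pow hp.1.symm
  have hm : g (Sum.inl 1) (Sum.inl 1) = 1 := eq_one_of_pow hp.2.symm
  have hs := hg
  rw [← fromBlocks_toBlocks g, SymplecticGroup.fromBlocks_mem_iff] at hs
  obtain ⟨-, s2, s3⟩ := hs
  have d00 := congrFun (congrFun s3 0) 0
  have d01 := congrFun (congrFun s3 0) 1
  have d10 := congrFun (congrFun s3 1) 0
  have d11 := congrFun (congrFun s3 1) 1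
  have q := congrFun (congrFun s2 0) 1
  simp [Matrix.mul_apply, Fin.sum_univ_two, toBlocks₁₁, toBlocks₁₂, toBlocks₂₁, toBlocks₂₂,
    e1, e2, e3, e4, e5, hl, hm] at d00 d01 d10 d11 q
  simp [d00, d01] at d10 d11 q
  simp [d11] at q
  have d10' := CharTwo.add_eq_zero.1 d10
  refine ⟨⟨g (Sum.inl 0) (Sum.inl 1), g (Sum.inl 0) (Sum.inr 0) +
    g (Sum.inl 0) (Sum.inr 1) * g (Sum.inl 0) (Sum.inl 1), g (Sum.inl 0) (Sum.inr 1),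
    g (Sum.inl 1) (Sum.inr 1)⟩, ?_⟩
  apply Subtype.ext
  change mat _ = g
  ext i j
  rcases i with i | i <;> rcases j with j | j <;> fin_cases i <;> fin_cases j <;>
    simp [mat, hl, hm, e1, e2, e3, e4, e5, d00, d01, d11, d10', q]
  · linear_combination (g (Sum.inl 0) (Sum.inr 1) * g (Sum.inr 1) (Sum.inr 0)) * (two0 (F := F))
  · rw [← d10']; ring

lemma center_triv (g : symplecticGroup (Fin 2) F) (hg : g ∈ Subgroup.center _) : g = 1 := by
  rw [Subgroup.mem_center_iff] at hg
  obtain ⟨g, hgs⟩ := g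
  have hU : ∀ x : UG F, mat x * g = g * mat x := fun x => congrArg Subtype.val (hg (phi x))
  have hL : ∀ x : UG F, (mat x)ᵀ * g = g * (mat x)ᵀ := fun x =>
    congrArg Subtype.val (hg ⟨(mat x)ᵀ, SymplecticGroup.transpose_mem (mat_mem x)⟩)
  have ext' : ∀ {M N : Matrix (Fin 2 ⊕ Fin 2) (Fin 2 ⊕ Fin 2) F}, M = N → ∀ i j, M i j = N i j :=
    fun h i j => by rw [h]
  have t1 := ext' (hU ⟨1, 0, 0, 0⟩)
  have t2 := ext' (hL ⟨1, 0, 0, 0⟩)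
  have t3 := ext' (hU ⟨0, 1, 0, 0⟩)
  have t4 := ext' (hL ⟨0, 1, 0, 0⟩)
  have t5 := ext' (hU ⟨0, 0, 0, 1⟩)
  have t6 := ext' (hL ⟨0, 0, 0, 1⟩)
  simp [mat, Matrix.mul_apply, Fintype.sum_sum_type, Fin.sum_univ_two] at t1 t2 t3 t4 t5 t6
  have hs := hgs
  rw [← fromBlocks_toBlocks g, SymplecticGroup.fromBlocks_mem_iff] at hs
  obtain ⟨-, s2, s3⟩ := hs
  have d00 := congrFun (congrFun s3 0) 0
  simp [Matrix.mul_apply, Fin.sum_univ_two, toBlocks₁₁, toBlocks₁₂, toBlocks₂₁, toBlocks₂₂] at d00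
  apply Subtype.ext
  change g = 1
  obtain ⟨⟨⟨⟨a1, a2⟩, a3, a4⟩, -⟩, ⟨a5, a6⟩, ⟨-, a7⟩, a8, -⟩ := t1
  obtain ⟨⟨⟨b1, b2⟩, ⟨b3, -⟩, -, b4⟩, ⟨⟨b5, b6⟩, b7, b8⟩, -⟩ := t2
  obtain ⟨⟨⟨⟨-, c1⟩, c2, -⟩, -⟩, -, c3⟩ := t3
  obtain ⟨⟨-, c4⟩, ⟨-, -, c5⟩, -⟩ := t4
  simp [b1, b2, b7] at a2 a8 c2
  simp [a1, a5, c2, c3] at d00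
  have h1 : g (Sum.inl 0) (Sum.inl 0) = 1 :=
    eq_one_of_pow (k := 1) (by rw [pow_one, pow_two]; exact d00)
  ext i j
  rcases i with i | i <;> rcases j with j | j <;> fin_cases i <;> fin_cases j <;>
    simp [a1, a4, a5, a6, b1, b2, b6, b7, c1, c3, c4, c5, a2, c2, ← a8, h1]

variable (F) in
lemma exists_sylow [Finite F] :
    ∃ P : Sylow 2 (symplecticGroup (Fin 2) F), (P : Subgroup _) = (phi (F := F)).range := by
  have : Fact (Nat.Prime 2) := ⟨Nat.prime_two⟩
  have := finite_UG (F := F)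
  have hUG : IsPGroup 2 (UG F) := by
    have := Fintype.ofFinite F
    obtain ⟨n, -, hn⟩ := FiniteField.card F 2
    apply IsPGroup.of_card (n := n * 4)
    rw [card_UG, Nat.card_eq_fintype_card, hn, ← pow_mul]
  have hr : IsPGroup 2 (phi (F := F)).range := by
    exact hUG.of_surjective _ (phi (F := F)).rangeRestrict_surjective
  obtain ⟨P, hP⟩ := hr.exists_le_sylow
  refine ⟨P, ?_⟩
  have hnil : Group.IsNilpotent P := P.isPGroup'.isNilpotent
  have hnc := normalizerCondition_iff_only_full_group_self_normalizing.1
    (Group.normalizerCondition_of_isNilpotent (G := P)) ((phi (F := F)).range.subgroupOf P) ?_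
  · exact le_antisymm (Subgroup.subgroupOf_eq_top.1 hnc) hP
  · apply le_antisymm _ Subgroup.le_normalizer
    intro g hg
    rw [Subgroup.mem_normalizer_iff''] at hg
    obtain ⟨k, hk⟩ := P.isPGroup' g
    rw [Subgroup.mem_subgroupOf]
    apply norm_mem (g : symplecticGroup (Fin 2) F) k (congrArg Subtype.val hk)
    intro x
    obtain ⟨y, hy⟩ := (hg ⟨phi x, hP ⟨x, rfl⟩⟩).1 ⟨x, rfl⟩
    refine ⟨y, ?_⟩
    rw [hy]
    simp [mul_assoc]

end UG

/-- Let `G ≅ PSp₄(2^b)`, `b ≥ 2`, `S ∈ Syl₂(G)`, and `A` an elementary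
abelian subgroup of `S` of maximal order. If `R ≤ S` satisfies `|RA/A| ≥ 4`, then
`|[R, A]| = 2^{2b}`. -/
theorem stmt_17 (b : ℕ) (hb : 2 ≤ b)
    (S : Sylow 2 (PSp4 b)) (A R : Subgroup (PSp4 b))
    (hAS : A ≤ S) (hRS : R ≤ S)
    (hAel : ∀ x ∈ A, x * x = 1)
    (hAmax : ∀ C : Subgroup (PSp4 b), C ≤ S → (∀ x ∈ C, x * x = 1) →
      Nat.card C ≤ Nat.card A)
    (hRA : 4 * Nat.card (R ⊓ A : Subgroup (PSp4 b)) ≤ Nat.card R) :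
    Nat.card (⁅R, A⁆ : Subgroup (PSp4 b)) = 2 ^ (2 * b) := by
  have : Fact (Nat.Prime 2) := ⟨Nat.prime_two⟩
  obtain ⟨P, hP⟩ := UG.exists_sylow (GaloisField 2 b)
  let π : Matrix.symplecticGroup (Fin 2) (GaloisField 2 b) →* PSp4 b := QuotientGroup.mk' _
  have hπs : Function.Surjective π := QuotientGroup.mk'_surjective _
  have hπi : Function.Injective π := by
    rw [injective_iff_map_eq_one]
    intro g hg
    exact UG.center_triv g ((QuotientGroup.eq_one_iff g).1 hg)
  have hfin : Finite (PSp4 b) := Finite.of_surjective π hπs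
  obtain ⟨g, hg⟩ := MulAction.exists_smul_eq (PSp4 b) (P.mapSurjective hπs) S
  let ψ : UG (GaloisField 2 b) →* PSp4 b :=
    (MulAut.conj g).toMonoidHom.comp (π.comp UG.phi)
  have hψi : Function.Injective ψ :=
    (MulAut.conj g).injective.comp (hπi.comp UG.phi_inj)
  have hψS : ψ.range = S := by
    rw [← hg, Sylow.coe_subgroup_smul, Sylow.coe_mapSurjective, hP, MonoidHom.map_range]
    exact MonoidHom.range_comp _ _
  have hA' : (A.comap ψ).map ψ = A := Subgroup.map_comap_eq_self (by rw [hψS]; exact hAS)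
  have hR' : (R.comap ψ).map ψ = R := Subgroup.map_comap_eq_self (by rw [hψS]; exact hRS)
  have hcard : ∀ H : Subgroup (UG (GaloisField 2 b)), Nat.card (H.map ψ) = Nat.card H :=
    fun H => Subgroup.card_map_of_injective hψi
  have hq : Nat.card (GaloisField 2 b) = 2 ^ b := GaloisField.card 2 b (by omega)
  have key := UG.core (A.comap ψ) (R.comap ψ) ?_ ?_ ?_
  · rw [← hcard, Subgroup.map_commutator, hA', hR', hq, ← pow_mul, mul_comm] at key
    exact key
  · intro x hx
    apply hψi
    rw [map_mul, map_one]
    exact hAel _ hx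
  · rw [← hcard, hA', ← UG.card_t, ← hcard]
    apply hAmax
    · rw [← hψS]; exact Subgroup.map_le_range _ _
    · rintro _ ⟨x, hx, rfl⟩
      rw [← map_mul, ← map_one ψ]
      congr 1
      have hx : x.t = 0 := hx
      ext <;> simp [hx, CharTwo.add_self_eq_zero]
  · rw [← Subgroup.comap_inf, ← hcard, ← hcard, hR',
      Subgroup.map_comap_eq_self (by rw [hψS]; exact inf_le_left.trans hRS)]
    exact hRA
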